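/- arXiv:2605.11833 — 3 statements merged into one kernel-verified Lean document; each statement's English description precedes it below -/
import Mathlib

section
/- Theorem 5.6(2) (walks through outdegree-one boundary points give unique preperiodic addresses): Let K be the attractor of a system of injective contractions S_i (i ∈ I) on a complete metric space with finite self-similar boundary ∂K. Suppose there are sequences ι : ℕ → I and q : ℕ → ∂K with q(0) = p and S_{ι(n)}(q(n+1)) = q(n) for all n, and suppose that for every n the pair (ι(n), q(n+1)) is the unique pair (k, r) ∈ I × ∂K satisfying S_k(r) = q(n). Then p has exactly one address, namely ι, and this address is preperiodic: there exist N ≥ 0 and T ≥ 1 such that ι(n+T) = ι(n) for all n ≥ N. -/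
/-- `SWord S w` is the composition `S_{i₁} ∘ ⋯ ∘ S_{iₙ}` for the word `w = i₁…iₙ`
(the identity for the empty word). -/
def SWord {X : Type*} {m : ℕ} (S : Fin m → X → X) : List (Fin m) → X → X
  | [] => id
  | i :: w => S i ∘ SWord S w

/-- `α : ℕ → Fin m` is an address of `x` if `x ∈ K_{α|n} = S_{α(0)…α(n-1)}(K)`
for every `n ≥ 1`. -/
def IsAddress {X : Type*} {m : ℕ} (S : Fin m → X → X) (K : Set X) (x : X)
    (α : ℕ → Fin m) : Prop :=
  ∀ n : ℕ, 1 ≤ n → x ∈ SWord S (List.ofFn fun k : Fin n => α k.val) '' K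

/-- The critical set `C = ⋃_{i ≠ j} (K_i ∩ K_j)`. -/
def CriticalSet {X : Type*} {m : ℕ} (S : Fin m → X → X) (K : Set X) : Set X :=
  ⋃ (i : Fin m) (j : Fin m) (_ : i ≠ j), (S i '' K) ∩ (S j '' K)

/-- The self-similar boundary
`∂K = {x ∈ K : S_w(x) ∈ C for some nonempty word w}`. -/
def SSBoundary {X : Type*} {m : ℕ} (S : Fin m → X → X) (K : Set X) : Set X :=
  {x | x ∈ K ∧ ∃ w : List (Fin m), w ≠ [] ∧ SWord S w x ∈ CriticalSet S K}

/-- `K` is a dendrite: compact, connected, locally connected (as a subspace), and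
admitting no continuous injection of the unit circle. -/
def IsDendrite {X : Type*} [TopologicalSpace X] (K : Set X) : Prop :=
  IsCompact K ∧ IsConnected K ∧ LocallyConnectedSpace K ∧
    ∀ f : (Metric.sphere (0 : ℂ) 1) → K, Continuous f → ¬ Function.Injective f

/-- The set of connected components of the set `A`. -/
def ComponentsIn {X : Type*} [TopologicalSpace X] (A : Set X) : Set (Set X) :=
  {C | ∃ y ∈ A, C = connectedComponentIn A y}

/-- The main tree of `K`: the intersection of all closed connected sets `A` with
`∂K ⊆ A ⊆ K`. -/
def MainTree {X : Type*} [TopologicalSpace X] {m : ℕ} (S : Fin m → X → X)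
    (K : Set X) : Set X :=
  ⋂₀ {A : Set X | IsClosed A ∧ IsConnected A ∧ SSBoundary S K ⊆ A ∧ A ⊆ K}

theorem SWord_append {X : Type*} {m : ℕ} (S : Fin m → X → X) (v w : List (Fin m)) (x : X) :
    SWord S (v ++ w) x = SWord S v (SWord S w x) := by
  induction v with
  | nil => rfl
  | cons i v ih => exact congrArg (S i) ih

/-- A point of `K` mapped into the boundary by some `S i` is itself in the boundary. -/
theorem SSBoundary.of_map {X : Type*} {m : ℕ} {S : Fin m → X → X} {K : Set X} {i : Fin m} {y : X}
    (hy : y ∈ K) (h : S i y ∈ SSBoundary S K) : y ∈ SSBoundary S K := by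
  obtain ⟨-, w, -, hw⟩ := h
  refine ⟨hy, w ++ [i], by simp, ?_⟩
  rwa [SWord_append]

theorem SWord_mem {X : Type*} {m : ℕ} {S : Fin m → X → X} {K : Set X}
    (hS : ∀ i, Set.MapsTo (S i) K K) (w : List (Fin m)) {x : X} (hx : x ∈ K) :
    SWord S w x ∈ K := by
  induction w with
  | nil => exact hx
  | cons i w ih => exact hS i ih

/-- Along a walk with unique boundary steps, a word `w` with `q k ∈ S_w(K)` spells the walk. -/
theorem getElem_eq_of_mem_image_SWord {X : Type*} {m : ℕ} {S : Fin m → X → X} {K : Set X}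
    (hS : ∀ i, Set.MapsTo (S i) K K) {ι : ℕ → Fin m} {q : ℕ → X}
    (hq : ∀ n, q n ∈ SSBoundary S K)
    (huniq : ∀ n, ∀ kr : Fin m × X, kr.2 ∈ SSBoundary S K → S kr.1 kr.2 = q n →
      kr = (ι n, q (n + 1)))
    (w : List (Fin m)) (k : ℕ) (hw : q k ∈ SWord S w '' K) (n : ℕ) (hn : n < w.length) :
    w[n] = ι (k + n) := by
  induction w generalizing k n with
  | nil => simp at hn
  | cons i w ih =>
    obtain ⟨x, hx, hxq⟩ := hw
    change S i (SWord S w x) = q k at hxq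
    have hb : SWord S w x ∈ SSBoundary S K :=
      SSBoundary.of_map (SWord_mem hS w hx) (hxq ▸ hq k)
    obtain ⟨hi, hy⟩ := Prod.mk.inj (huniq k (i, SWord S w x) hb hxq)
    cases n with
    | zero => exact hi
    | succ n =>
      rw [List.getElem_cons_succ, ih (k + 1) ⟨x, hx, hy⟩ n (by simpa using hn)]
      congr 1
      omega

theorem SWord_ofFn_walk {X : Type*} {m : ℕ} {S : Fin m → X → X} {ι : ℕ → Fin m} {q : ℕ → X}
    (hstep : ∀ n, S (ι n) (q (n + 1)) = q n) (n : ℕ) :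
    SWord S (List.ofFn fun k : Fin n => ι k.val) (q n) = q 0 := by
  induction n with
  | zero => rfl
  | succ n ih =>
    rw [List.ofFn_succ', List.concat_eq_append, SWord_append]
    simpa [SWord, hstep] using ih

/-- **Theorem 5.6(2)**: a walk through boundary points of outdegree one gives a unique,
preperiodic address. -/
theorem unique_preperiodic_address_of_outdegree_one_walk
    {X : Type*} [MetricSpace X] [CompleteSpace X] {m : ℕ}
    (S : Fin m → X → X) (r : Fin m → NNReal) (hr : ∀ i, r i < 1)
    (hlip : ∀ i, LipschitzWith (r i) (S i)) (hinj : ∀ i, Function.Injective (S i))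
    (K : Set X) (hKne : K.Nonempty) (hKcp : IsCompact K) (hKeq : K = ⋃ i, S i '' K)
    (hfin : (SSBoundary S K).Finite)
    (p : X) (ι : ℕ → Fin m) (q : ℕ → X)
    (hq : ∀ n, q n ∈ SSBoundary S K) (hq0 : q 0 = p)
    (hstep : ∀ n, S (ι n) (q (n + 1)) = q n)
    (huniq : ∀ n, ∀ kr : Fin m × X, kr.2 ∈ SSBoundary S K → S kr.1 kr.2 = q n →
      kr = (ι n, q (n + 1))) :
    {α : ℕ → Fin m | IsAddress S K p α} = {ι} ∧
      ∃ N T : ℕ, 1 ≤ T ∧ ∀ n : ℕ, N ≤ n → ι (n + T) = ι n := by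
  have hS : ∀ i, Set.MapsTo (S i) K K := fun i x hx => by
    rw [hKeq]
    exact Set.mem_iUnion.2 ⟨i, x, hx, rfl⟩
  refine ⟨Set.eq_singleton_iff_unique_mem.2 ⟨fun n _ => ?_, fun α hα => ?_⟩, ?_⟩
  · exact ⟨q n, (hq n).1, (SWord_ofFn_walk hstep n).trans hq0⟩
  · funext n
    have h := hα (n + 1) (by omega)
    rw [← hq0] at h
    have hn : n < (List.ofFn fun k : Fin (n + 1) => α k.val).length := by
      rw [List.length_ofFn]
      omega
    have hw := getElem_eq_of_mem_image_SWord hS hq huniq _ 0 h n hn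
    rwa [List.getElem_ofFn, Nat.zero_add] at hw
  · obtain ⟨a, -, b, -, hab, heq⟩ :=
      Set.infinite_univ.exists_lt_map_eq_of_mapsTo (fun n _ => hq n) hfin
    have next : ∀ k l, q k = q l → ι k = ι l ∧ q (k + 1) = q (l + 1) := fun k l h =>
      Prod.mk.inj (huniq l (ι k, q (k + 1)) (hq _) ((hstep k).trans h))
    have shift : ∀ n, q (a + n) = q (b + n) := fun n => by
      induction n with
      | zero => exact heq
      | succ n ih => exact (next _ _ ih).2
    refine ⟨a, b - a, by omega, fun n hn => ?_⟩
    have h := (next _ _ (shift (n - a))).1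
    rw [show a + (n - a) = n by omega, show b + (n - a) = n + (b - a) by omega] at h
    exact h.symm
end

section
/- Proposition 5.3(4): Let G be a finite directed multigraph, p a vertex and c a circuit of G such that p is not a vertex of c, p reaches some vertex of c, and some vertex of c reaches p. Then the set of infinite walks starting at p is uncountable. -/
/-- There is an edge from `u` to `v`. -/
def Step {V E : Type} (src tgt : E → V) (u v : V) : Prop :=
  ∃ e : E, src e = u ∧ tgt e = v

/-- `u` reaches `v`: `u = v` or there is a finite walk from `u` to `v`. -/
def Reaches {V E : Type} (src tgt : E → V) : V → V → Prop :=
  Relation.ReflTransGen (Step src tgt)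

/-- An infinite walk starting at `p`. -/
def IsInfWalk {V E : Type} (src tgt : E → V) (p : V) (f : ℕ → E) : Prop :=
  src (f 0) = p ∧ ∀ n : ℕ, tgt (f n) = src (f (n + 1))

/-- An eventually periodic sequence of edges. -/
def EventuallyPeriodic {E : Type} (f : ℕ → E) : Prop :=
  ∃ N T : ℕ, 1 ≤ T ∧ ∀ n : ℕ, N ≤ n → f (n + T) = f n

/-- A circuit: a nonempty closed finite walk whose vertices are pairwise distinct. -/
structure Circuit {V E : Type} (src tgt : E → V) where
  edges : List E
  ne : edges ≠ []
  chain : edges.Chain' fun e f => tgt e = src f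
  closed : tgt (edges.getLast ne) = src (edges.head ne)
  nodup : (edges.map src).Nodup

/-- The list of vertices of a circuit. -/
def Circuit.verts {V E : Type} {src tgt : E → V} (c : Circuit src tgt) : List V :=
  c.edges.map src

/-- There is a walk of length `n` from `u` to `v`. -/
def ReachesIn {V E : Type} (src tgt : E → V) (v : V) : ℕ → V → Prop
  | 0, u => u = v
  | n + 1, u => ∃ e, src e = u ∧ ReachesIn src tgt v n (tgt e)

theorem Reaches.exists_reachesIn {V E : Type} {src tgt : E → V} {u v : V}
    (h : Reaches src tgt u v) : ∃ n, ReachesIn src tgt v n u := by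
  unfold Reaches at h
  induction h using Relation.ReflTransGen.head_induction_on with
  | refl => exact ⟨0, rfl⟩
  | head h _ ih =>
    obtain ⟨e, rfl, rfl⟩ := h
    obtain ⟨n, hn⟩ := ih
    exact ⟨n + 1, e, rfl, hn⟩

theorem ReachesIn.reaches {V E : Type} {src tgt : E → V} {v : V} {n : ℕ} :
    ∀ {u : V}, ReachesIn src tgt v n u → Reaches src tgt u v := by
  induction n with
  | zero => rintro u rfl; exact .refl
  | succ n ih =>
    rintro _ ⟨e, rfl, h⟩
    exact .head ⟨e, rfl, rfl⟩ (ih h)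

/-- An edge leaving each vertex `u ≠ v` that reaches `v`, chosen to decrease the distance to `v`. -/
theorem exists_descent {V E : Type} [Nonempty E] (src tgt : E → V) (v : V) :
    ∃ (next : V → E) (d : V → ℕ), ∀ u, Reaches src tgt u v → u ≠ v →
      src (next u) = u ∧ Reaches src tgt (tgt (next u)) v ∧ d (tgt (next u)) < d u := by
  let d : V → ℕ := fun u => sInf {n | ReachesIn src tgt v n u}
  have key : ∀ u, ∃ e, Reaches src tgt u v → u ≠ v →
      src e = u ∧ Reaches src tgt (tgt e) v ∧ d (tgt e) < d u := by
    intro u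
    by_cases hu : Reaches src tgt u v ∧ u ≠ v
    · have hd : ReachesIn src tgt v (d u) u := Nat.sInf_mem hu.1.exists_reachesIn
      rcases hn : d u with _ | n
      · rw [hn] at hd
        exact absurd hd hu.2
      · rw [hn] at hd
        obtain ⟨e, he, h⟩ := hd
        exact ⟨e, fun _ _ => ⟨he, h.reaches, Nat.lt_succ_of_le (Nat.sInf_le h)⟩⟩
    · exact ⟨Classical.arbitrary E, fun h₁ h₂ => absurd ⟨h₁, h₂⟩ hu⟩
  choose next hnext using key
  exact ⟨next, d, hnext⟩

section Coding

variable {V E : Type} (tgt : E → V) (v : V) (branch : Bool → E) (next : V → E)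

open Classical in
/-- The edge taken at a vertex: at `v`, the branch prescribed by the first bit. -/
noncomputable def codedEdge (s : V × (ℕ → Bool)) : E :=
  if s.1 = v then branch (s.2 0) else next s.1

open Classical in
/-- Follow the coded edge, consuming a bit at each visit of `v`. -/
noncomputable def codedStep (s : V × (ℕ → Bool)) : V × (ℕ → Bool) :=
  (tgt (codedEdge v branch next s), if s.1 = v then fun n => s.2 (n + 1) else s.2)

/-- The infinite sequence of edges coded by a starting vertex and a sequence of bits. -/
noncomputable def codedWalk (s : V × (ℕ → Bool)) (n : ℕ) : E :=
  codedEdge v branch next ((codedStep tgt v branch next)^[n] s)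

theorem codedWalk_codedStep (s : V × (ℕ → Bool)) (n : ℕ) :
    codedWalk tgt v branch next (codedStep tgt v branch next s) n =
      codedWalk tgt v branch next s (n + 1) := rfl

variable {tgt v branch next} {src : E → V}

theorem codedEdge_spec (hsrc : ∀ b, src (branch b) = v)
    (hback : ∀ b, Reaches src tgt (tgt (branch b)) v)
    (hnext : ∀ u, Reaches src tgt u v → u ≠ v →
      src (next u) = u ∧ Reaches src tgt (tgt (next u)) v)
    {s : V × (ℕ → Bool)} (hs : Reaches src tgt s.1 v) :
    src (codedEdge v branch next s) = s.1 ∧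
      Reaches src tgt (tgt (codedEdge v branch next s)) v := by
  unfold codedEdge
  split_ifs with h
  · exact ⟨(hsrc _).trans h.symm, hback _⟩
  · exact hnext _ hs h

theorem isInfWalk_codedWalk (hsrc : ∀ b, src (branch b) = v)
    (hback : ∀ b, Reaches src tgt (tgt (branch b)) v)
    (hnext : ∀ u, Reaches src tgt u v → u ≠ v →
      src (next u) = u ∧ Reaches src tgt (tgt (next u)) v)
    {s : V × (ℕ → Bool)} (hs : Reaches src tgt s.1 v) :
    IsInfWalk src tgt s.1 (codedWalk tgt v branch next s) := by
  have hreach : ∀ n, Reaches src tgt ((codedStep tgt v branch next)^[n] s).1 v := by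
    intro n
    induction n with
    | zero => exact hs
    | succ n ih =>
      rw [Function.iterate_succ_apply']
      exact (codedEdge_spec hsrc hback hnext ih).2
  refine ⟨(codedEdge_spec hsrc hback hnext hs).1, fun n => ?_⟩
  have h := (codedEdge_spec hsrc hback hnext (hreach (n + 1))).1
  rw [codedWalk, codedWalk, h, Function.iterate_succ_apply']
  rfl

theorem codedWalk_bits_eq (hbranch : Function.Injective branch)
    (hback : ∀ b, Reaches src tgt (tgt (branch b)) v) {d : V → ℕ}
    (hnext : ∀ u, Reaches src tgt u v → u ≠ v →
      src (next u) = u ∧ Reaches src tgt (tgt (next u)) v ∧ d (tgt (next u)) < d u) (k : ℕ) :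
    ∀ (u : V) (x y : ℕ → Bool), Reaches src tgt u v →
      codedWalk tgt v branch next (u, x) = codedWalk tgt v branch next (u, y) → x k = y k := by
  induction k with
  | zero =>
    intro u
    induction hn : d u using Nat.strong_induction_on generalizing u with
    | _ n ih =>
      intro x y hu hxy
      by_cases h : u = v
      · have h0 := congrFun hxy 0
        exact hbranch (by simpa [codedWalk, codedEdge, h] using h0)
      · obtain ⟨-, h₂, h₃⟩ := hnext u hu h
        refine ih _ (hn ▸ h₃) _ rfl x y h₂ (funext fun n => ?_)
        have h0 := congrFun hxy (n + 1)
        simpa [← codedWalk_codedStep, codedStep, codedEdge, h] using h0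
  | succ k ihk =>
    intro u
    induction hn : d u using Nat.strong_induction_on generalizing u with
    | _ n ih =>
      intro x y hu hxy
      by_cases h : u = v
      · have hb : x 0 = y 0 := hbranch (by
          simpa [codedWalk, codedEdge, h] using congrFun hxy 0)
        refine ihk (tgt (branch (x 0))) (fun n => x (n + 1)) (fun n => y (n + 1)) (hback _)
          (funext fun n => ?_)
        have h0 := congrFun hxy (n + 1)
        simpa [← codedWalk_codedStep, codedStep, codedEdge, h, hb] using h0
      · obtain ⟨-, h₂, h₃⟩ := hnext u hu h
        refine ih _ (hn ▸ h₃) _ rfl x y h₂ (funext fun n => ?_)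
        have h0 := congrFun hxy (n + 1)
        simpa [← codedWalk_codedStep, codedStep, codedEdge, h] using h0

end Coding

/-- If two distinct edges leaving `v` both lead back to `v`, then uncountably many infinite walks
start at each vertex that reaches `v`. -/
theorem not_countable_walks_of_branch {V E : Type} {src tgt : E → V} {p v : V} {e₁ e₂ : E}
    (hne : e₁ ≠ e₂) (h₁ : src e₁ = v) (h₂ : src e₂ = v) (hb₁ : Reaches src tgt (tgt e₁) v)
    (hb₂ : Reaches src tgt (tgt e₂) v) (hpv : Reaches src tgt p v) :
    ¬ {f : ℕ → E | IsInfWalk src tgt p f}.Countable := by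
  have : Nonempty E := ⟨e₁⟩
  obtain ⟨next, d, hnext⟩ := exists_descent src tgt v
  let branch : Bool → E := fun b => cond b e₁ e₂
  have hbranch : Function.Injective branch := by
    rintro (_ | _) (_ | _) h
    exacts [rfl, absurd h.symm hne, absurd h hne, rfl]
  have hsrc : ∀ b, src (branch b) = v := by rintro (_ | _) <;> assumption
  have hback : ∀ b, Reaches src tgt (tgt (branch b)) v := by rintro (_ | _) <;> assumption
  intro hc
  have hinj : Function.Injective fun x : ℕ → Bool =>
      (⟨codedWalk tgt v branch next (p, x), isInfWalk_codedWalk hsrc hback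
        (fun u hu huv => ⟨(hnext u hu huv).1, (hnext u hu huv).2.1⟩) hpv⟩ :
        {f : ℕ → E | IsInfWalk src tgt p f}) := fun x y hxy =>
    funext fun k => codedWalk_bits_eq hbranch hback hnext k p x y hpv (congrArg Subtype.val hxy)
  have := hc.to_subtype
  have hcard : Cardinal.mk (ℕ → Bool) = Cardinal.continuum := by simp
  have : Countable (ℕ → Bool) := hinj.countable
  exact Cardinal.aleph0_lt_continuum.not_ge (hcard ▸ Cardinal.mk_le_aleph0)

namespace Circuit

variable {V E : Type} {src tgt : E → V} (c : Circuit src tgt)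

/-- The edges of a circuit, repeated cyclically. -/
def cycEdge (n : ℕ) : E :=
  c.edges[n % c.edges.length]'(Nat.mod_lt _ (List.length_pos_of_ne_nil c.ne))

theorem tgt_cycEdge (n : ℕ) : tgt (c.cycEdge n) = src (c.cycEdge (n + 1)) := by
  have hpos := List.length_pos_of_ne_nil c.ne
  have hlt := Nat.mod_lt n hpos
  unfold cycEdge
  by_cases h : n % c.edges.length + 1 < c.edges.length
  · have hmod : (n + 1) % c.edges.length = n % c.edges.length + 1 := by
      rw [← Nat.mod_add_mod, Nat.mod_eq_of_lt h]
    simp only [hmod]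
    exact List.isChain_iff_getElem.1 c.chain _ h
  · have hlast : n % c.edges.length = c.edges.length - 1 := by omega
    have hmod : (n + 1) % c.edges.length = 0 := by
      rw [← Nat.mod_add_mod, show n % c.edges.length + 1 = c.edges.length by omega, Nat.mod_self]
    have := c.closed
    rw [List.getLast_eq_getElem, List.head_eq_getElem] at this
    simpa only [hmod, hlast] using this

theorem src_cycEdge_mem (n : ℕ) : src (c.cycEdge n) ∈ c.verts :=
  List.mem_map_of_mem (List.getElem_mem _)

theorem exists_cycEdge {v : V} (hv : v ∈ c.verts) :
    ∃ n < c.edges.length, src (c.cycEdge n) = v := by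
  obtain ⟨e, he, rfl⟩ := List.mem_map.1 hv
  obtain ⟨n, hn, rfl⟩ := List.getElem_of_mem he
  exact ⟨n, hn, by simp only [cycEdge, Nat.mod_eq_of_lt hn]⟩

theorem reaches_add (m n : ℕ) :
    Reaches src tgt (src (c.cycEdge m)) (src (c.cycEdge (m + n))) := by
  induction n with
  | zero => exact .refl
  | succ n ih => exact ih.tail ⟨_, rfl, c.tgt_cycEdge _⟩

theorem reaches {u v : V} (hu : u ∈ c.verts) (hv : v ∈ c.verts) : Reaches src tgt u v := by
  obtain ⟨m, hm, rfl⟩ := c.exists_cycEdge hu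
  obtain ⟨n, -, rfl⟩ := c.exists_cycEdge hv
  have h := c.reaches_add m (n + c.edges.length - m)
  rw [show m + (n + c.edges.length - m) = n + c.edges.length by omega] at h
  simpa only [cycEdge, Nat.add_mod_right] using h

theorem exists_edge {v : V} (hv : v ∈ c.verts) : ∃ e, src e = v ∧ tgt e ∈ c.verts := by
  obtain ⟨n, -, rfl⟩ := c.exists_cycEdge hv
  exact ⟨_, rfl, c.tgt_cycEdge n ▸ c.src_cycEdge_mem _⟩

/-- A walk from a vertex of a circuit to a vertex off it leaves the circuit along some edge. -/
theorem exists_exit {u p : V} (hu : u ∈ c.verts) (hp : p ∉ c.verts) (h : Reaches src tgt u p) :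
    ∃ e, src e ∈ c.verts ∧ tgt e ∉ c.verts ∧ Reaches src tgt (tgt e) p := by
  unfold Reaches at h
  induction h using Relation.ReflTransGen.head_induction_on with
  | refl => exact absurd hu hp
  | head h hr ih =>
    obtain ⟨e, rfl, rfl⟩ := h
    by_cases he : tgt e ∈ c.verts
    · exact ih he
    · exact ⟨e, hu, he, hr⟩

end Circuit

/-- **Proposition 5.3(4)**: if `p` is not on the circuit `c` but `p` and `c` are linked,
then the set of infinite walks starting at `p` is uncountable. -/
theorem uncountably_many_walks_of_vertex_linked_to_circuit
    {V E : Type} [Finite V] [Finite E] (src tgt : E → V) (p : V)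
    (c : Circuit src tgt) (hp : p ∉ c.verts)
    (hto : ∃ v ∈ c.verts, Reaches src tgt p v)
    (hfrom : ∃ v ∈ c.verts, Reaches src tgt v p) :
    ¬ {f : ℕ → E | IsInfWalk src tgt p f}.Countable := by
  obtain ⟨v, hv, hpv⟩ := hto
  obtain ⟨u, hu, hup⟩ := hfrom
  obtain ⟨e, he, hte, hep⟩ := c.exists_exit hu hp hup
  obtain ⟨e', he', hte'⟩ := c.exists_edge he
  have hpe : Reaches src tgt p (src e) := hpv.trans (c.reaches hv he)
  have hne : e ≠ e' := fun h => hte (h ▸ hte')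
  exact not_countable_walks_of_branch hne rfl he' (hep.trans hpe) (c.reaches hte' he) hpe
end

section
/- Proposition 5.2(3): Let K be the attractor of a system of injective contractions S_i (i ∈ I) on a complete metric space, suppose K is a dendrite and the self-similar boundary ∂K is finite, and let T be the main tree of K. Then every cut point of K lies in an image of the main tree: if K \ {x} has at least two connected components, then x ∈ S_w(T) for some finite word w over I (possibly the empty word, in which case S_w is the identity). -/
open Set in
theorem IsPreconnected.replace_piece {X : Type*} [TopologicalSpace X] {P R A : Set X}
    (hPR : IsPreconnected (P ∪ R)) (hP : IsClosed P) (hR : IsClosed R)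
    (hA : IsPreconnected A) (hAP : A ⊆ P) (hPRA : P ∩ R ⊆ A) :
    IsPreconnected (A ∪ R) := by
  have key : ∀ t t' : Set X, IsClosed t → IsClosed t' → A ∪ R ⊆ t ∪ t' →
      ((A ∪ R) ∩ t).Nonempty → ((A ∪ R) ∩ t').Nonempty → A ⊆ t →
      ((A ∪ R) ∩ (t ∩ t')).Nonempty := by
    rintro t t' ht ht' hcov ⟨a, ha, hat⟩ ⟨b, hb, hbt'⟩ hAt
    rcases hb with hb | hb
    · exact ⟨b, Or.inl hb, hAt hb, hbt'⟩
    have hsep := isPreconnected_closed_iff.1 hPR (P ∪ (R ∩ t)) (R ∩ t')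
      (hP.union (hR.inter ht)) (hR.inter ht') ?_ ?_ ⟨b, Or.inr hb, hb, hbt'⟩
    · obtain ⟨c, -, hc, hcR, hct'⟩ := hsep
      refine ⟨c, Or.inr hcR, ?_, hct'⟩
      rcases hc with hc | hc
      · exact hAt (hPRA ⟨hc, hcR⟩)
      · exact hc.2
    · rintro c (hc | hc)
      · exact Or.inl (Or.inl hc)
      · rcases hcov (Or.inr hc) with h | h
        · exact Or.inl (Or.inr ⟨hc, h⟩)
        · exact Or.inr ⟨hc, h⟩
    · rcases ha with ha | ha
      · exact ⟨a, Or.inl (hAP ha), Or.inl (hAP ha)⟩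
      · exact ⟨a, Or.inr ha, Or.inr ⟨ha, hat⟩⟩
  rw [isPreconnected_closed_iff]
  intro t t' ht ht' hcov hn hn'
  have hA' : A ⊆ t ∨ A ⊆ t' ∨ (A ∩ (t ∩ t')).Nonempty := by
    by_contra! h
    obtain ⟨h1, h2, h3⟩ := h
    obtain ⟨a, ha, hat⟩ := not_subset.1 h1
    obtain ⟨b, hb, hbt⟩ := not_subset.1 h2
    have := isPreconnected_closed_iff.1 hA t t' ht ht' (subset_union_left.trans hcov)
      ⟨b, hb, (hcov (Or.inl hb)).resolve_right hbt⟩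
      ⟨a, ha, (hcov (Or.inl ha)).resolve_left hat⟩
    exact this.ne_empty h3
  rcases hA' with h | h | ⟨a, ha, hat⟩
  · exact key t t' ht ht' hcov hn hn' h
  · rw [inter_comm t t']
    exact key t' t ht' ht (union_comm t t' ▸ hcov) hn' hn h
  · exact ⟨a, Or.inl ha, hat⟩

section SWord

variable {X : Type*} {m : ℕ} {S : Fin m → X → X} {K : Set X}

theorem SWord_injective (hinj : ∀ i, Function.Injective (S i)) (w : List (Fin m)) :
    Function.Injective (SWord S w) := by
  induction w with
  | nil => exact Function.injective_id
  | cons i w ih => exact (hinj i).comp ih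

theorem SWord_image_subset (hK : ∀ i, S i '' K ⊆ K) (w : List (Fin m)) :
    SWord S w '' K ⊆ K := by
  induction w with
  | nil => exact (Set.image_id K).subset
  | cons i w ih =>
    rw [SWord, Set.image_comp]
    exact (Set.image_mono ih).trans (hK i)

theorem exists_mem_SWord_image (hKeq : K = ⋃ i, S i '' K) (n : ℕ) {x : X} (hx : x ∈ K) :
    ∃ w : List (Fin m), w.length = n ∧ x ∈ SWord S w '' K := by
  induction n generalizing x with
  | zero => exact ⟨[], rfl, x, hx, rfl⟩
  | succ n ih =>
    rw [hKeq] at hx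
    obtain ⟨i, y, hy, rfl⟩ := Set.mem_iUnion.1 hx
    obtain ⟨w, hw, z, hz, rfl⟩ := ih hy
    exact ⟨i :: w, by simp [hw], z, hz, rfl⟩

/-- Two distinct cells of the same level meet only at images of boundary points. -/
theorem mem_SSBoundary_of_mem_SWord_image (hinj : ∀ i, Function.Injective (S i))
    (hK : ∀ i, S i '' K ⊆ K) {w v : List (Fin m)} (hlen : w.length = v.length) (hne : w ≠ v)
    {q : X} (hq : q ∈ K) (h : SWord S w q ∈ SWord S v '' K) : q ∈ SSBoundary S K := by
  induction w generalizing v with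
  | nil => exact absurd (List.length_eq_zero_iff.1 hlen.symm).symm hne
  | cons i w ih =>
    cases v with
    | nil => simp at hlen
    | cons j v =>
      obtain ⟨p, hp, hpq⟩ := h
      change S j (SWord S v p) = S i (SWord S w q) at hpq
      by_cases hij : i = j
      · subst hij
        exact ih (by simpa using hlen) (by simpa using hne) ⟨p, hp, hinj i hpq⟩
      · refine ⟨hq, i :: w, List.cons_ne_nil _ _, ?_⟩
        simp only [CriticalSet, Set.mem_iUnion]
        exact ⟨i, j, hij, ⟨_, SWord_image_subset hK w ⟨q, hq, rfl⟩, rfl⟩,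
          ⟨_, SWord_image_subset hK v ⟨p, hp, rfl⟩, hpq⟩⟩

theorem SWord_lipschitzWith [PseudoEMetricSpace X] {ρ : NNReal}
    (hlip : ∀ i, LipschitzWith ρ (S i)) (w : List (Fin m)) :
    LipschitzWith (ρ ^ w.length) (SWord S w) := by
  induction w with
  | nil => simpa [SWord] using LipschitzWith.id
  | cons i w ih => simpa [SWord, pow_succ'] using (hlip i).comp ih

end SWord

/-- **Proposition 5.2(3)**: every cut point of a self-similar dendrite with finite
self-similar boundary lies in some image `S_w(T)` of the main tree `T`. -/
theorem cut_points_in_images_of_main_tree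
    {X : Type*} [MetricSpace X] [CompleteSpace X] {m : ℕ}
    (S : Fin m → X → X) (r : Fin m → NNReal) (hr : ∀ i, r i < 1)
    (hlip : ∀ i, LipschitzWith (r i) (S i)) (hinj : ∀ i, Function.Injective (S i))
    (K : Set X) (hKne : K.Nonempty) (hKcp : IsCompact K) (hKeq : K = ⋃ i, S i '' K)
    (hdend : IsDendrite K) (hfin : (SSBoundary S K).Finite)
    (x : X) (hx : x ∈ K)
    (hcut : ∃ C₁ ∈ ComponentsIn (K \ {x}), ∃ C₂ ∈ ComponentsIn (K \ {x}), C₁ ≠ C₂) :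
    ∃ w : List (Fin m), x ∈ SWord S w '' MainTree S K := by
  have hK : ∀ i, S i '' K ⊆ K := fun i ↦
    (Set.subset_iUnion (fun i ↦ S i '' K) i).trans hKeq.ge
  obtain ⟨_, ⟨y, hy, rfl⟩, _, ⟨z, hz, rfl⟩, hC⟩ := hcut
  by_contra! hnot
  obtain ⟨ρ, hρ, hrρ⟩ : ∃ ρ : NNReal, ρ < 1 ∧ ∀ i, r i ≤ ρ :=
    ⟨Finset.univ.sup r, (Finset.sup_lt_iff (by simp)).2 fun i _ ↦ hr i,
      fun i ↦ Finset.le_sup (Finset.mem_univ i)⟩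
  have hlipW := SWord_lipschitzWith fun i ↦ (hlip i).weaken (hrρ i)
  obtain ⟨n, hn⟩ : ∃ n : ℕ, (ρ : ℝ) ^ n * Metric.diam K < min (dist x y) (dist x z) := by
    have hpos : 0 < min (dist x y) (dist x z) :=
      lt_min (dist_pos.2 fun h ↦ hy.2 h.symm) (dist_pos.2 fun h ↦ hz.2 h.symm)
    have hlim := (tendsto_pow_atTop_nhds_zero_of_lt_one ρ.coe_nonneg
      (NNReal.coe_lt_one.2 hρ)).mul_const (Metric.diam K)
    rw [zero_mul] at hlim
    exact (hlim.eventually_lt_const hpos).exists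
  obtain ⟨w, hw, x', hx', rfl⟩ := exists_mem_SWord_image hKeq n hx
  have hdist : ∀ p ∈ SWord S w '' K, dist (SWord S w x') p ≤ (ρ : ℝ) ^ n * Metric.diam K := by
    rintro _ ⟨q, hq, rfl⟩
    refine ((hlipW w).dist_le_mul x' q).trans ?_
    rw [hw, NNReal.coe_pow]
    gcongr
    exact Metric.dist_le_diam_of_mem hKcp.isBounded hx' hq
  obtain ⟨A, ⟨-, hAconn, hbA, hAK⟩, hxA⟩ : ∃ A, (IsClosed A ∧ IsConnected A ∧
      SSBoundary S K ⊆ A ∧ A ⊆ K) ∧ x' ∉ A := by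
    by_contra! h
    exact hnot w ⟨x', fun A hA ↦ h A hA, rfl⟩
  have hcell : ∀ v, IsCompact (SWord S v '' K) := fun v ↦ hKcp.image (hlipW v).continuous
  let R : Set X := ⋃ v ∈ {v : List (Fin m) | v.length = n ∧ v ≠ w}, SWord S v '' K
  have hRcl : IsClosed R := by
    refine Set.Finite.isClosed_biUnion ?_ fun v _ ↦ (hcell v).isClosed
    exact (List.finite_length_eq (Fin m) n).subset fun v hv ↦ hv.1
  have hmeet : ∀ q ∈ K, SWord S w q ∈ R → q ∈ A := by
    intro q hq hqR
    obtain ⟨v, ⟨hv, hvw⟩, hqv⟩ := Set.mem_iUnion₂.1 hqR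
    exact hbA (mem_SSBoundary_of_mem_SWord_image hinj hK (hw.trans hv.symm) hvw.symm hq hqv)
  have hRK : R ⊆ K := Set.iUnion₂_subset fun v _ ↦ SWord_image_subset hK v
  have hcover : ∀ p ∈ K, p ∈ SWord S w '' K ∨ p ∈ R := by
    intro p hp
    obtain ⟨v, hv, hpv⟩ := exists_mem_SWord_image hKeq n hp
    by_cases hvw : v = w
    · exact Or.inl (hvw ▸ hpv)
    · exact Or.inr (Set.mem_biUnion (show v ∈ {v | v.length = n ∧ v ≠ w} from ⟨hv, hvw⟩) hpv)
  have hKunion : SWord S w '' K ∪ R = K :=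
    (Set.union_subset (SWord_image_subset hK w) hRK).antisymm hcover
  have hunion : IsPreconnected (SWord S w '' K ∪ R) := by
    rw [hKunion]
    exact hdend.2.1.isPreconnected
  have hL : IsPreconnected (SWord S w '' A ∪ R) := by
    refine IsPreconnected.replace_piece hunion (hcell w).isClosed
      hRcl (hAconn.isPreconnected.image _ (hlipW w).continuous.continuousOn)
      (Set.image_mono hAK) ?_
    rintro _ ⟨⟨q, hq, rfl⟩, hqR⟩
    exact ⟨q, hmeet q hq hqR, rfl⟩
  have hLsub : SWord S w '' A ∪ R ⊆ K \ {SWord S w x'} := by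
    rintro p (⟨q, hq, rfl⟩ | hp)
    · refine ⟨SWord_image_subset hK w ⟨q, hAK hq, rfl⟩, fun h ↦ hxA ?_⟩
      exact SWord_injective hinj w h ▸ hq
    · refine ⟨hRK hp, fun h ↦ hxA (hmeet x' hx' ?_)⟩
      exact (Set.mem_singleton_iff.1 h) ▸ hp
  have hyR : y ∈ R := (hcover y hy.1).resolve_left fun h ↦
    ((hdist y h).trans_lt hn).not_ge (min_le_left _ _)
  have hzR : z ∈ R := (hcover z hz.1).resolve_left fun h ↦
    ((hdist z h).trans_lt hn).not_ge (min_le_right _ _)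
  exact hC (connectedComponentIn_eq
    (hL.subset_connectedComponentIn (Or.inr hyR) hLsub (Or.inr hzR)))
end
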